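/- Let m, n, d ≥ 1 be integers, let P ∈ POL_{d,m×n} with first companion form C¹_P, and let L be any matrix pencil of size (m+n(d−1)) × nd such that dist(C¹_P, L) < π/(12 d^{3/2}). Then there exists P̃ ∈ POL_{d,m×n} such that L is strictly equivalent to C¹_{P̃} and dist(C¹_P, C¹_{P̃}) ≤ 4 d (1 + ‖P‖_F) · dist(C¹_P, L), where ‖P‖_F = (Σ_{i=0}^d ‖A_i‖_F²)^{1/2}. -/

import Mathlib

open Matrix Finset

namespace MPoly

/-- The space `POL_{d,m×n}` of `m × n` complex matrix polynomials of grade `d`,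
identified with the tuple of coefficients `(A_0, …, A_d)`. -/
abbrev Pol (d m n : ℕ) := Fin (d+1) → Matrix (Fin m) (Fin n) ℂ

/-- A matrix pencil `λ A + B` of size `p × q`, identified with the pair `(A, B)`. -/
abbrev Pencil (p q : ℕ) := Matrix (Fin p) (Fin q) ℂ × Matrix (Fin p) (Fin q) ℂ

/-- The metric on `POL_{d,m×n}`:  `dist(P,P') = (Σ_i ‖A_i − A'_i‖_F²)^(1/2)`. -/
noncomputable def polDist {m n d : ℕ} (P P' : Pol d m n) : ℝ :=
  Real.sqrt (∑ k, ∑ i, ∑ j, ‖P k i j - P' k i j‖ ^ 2)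

/-- The Frobenius norm of a matrix polynomial: `‖P‖_F = (Σ_i ‖A_i‖_F²)^(1/2)`. -/
noncomputable def polNorm {m n d : ℕ} (P : Pol d m n) : ℝ :=
  Real.sqrt (∑ k, ∑ i, ∑ j, ‖P k i j‖ ^ 2)

/-- The metric on pencils: `dist(λA+B, λA'+B') = (‖A−A'‖_F² + ‖B−B'‖_F²)^(1/2)`. -/
noncomputable def penDist {p q : ℕ} (L L' : Pencil p q) : ℝ :=
  Real.sqrt ((∑ i, ∑ j, ‖L.1 i j - L'.1 i j‖ ^ 2) + (∑ i, ∑ j, ‖L.2 i j - L'.2 i j‖ ^ 2))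

/-- The `λ`-part `A = diag(A_d, I_n, …, I_n)` of the first companion form. -/
noncomputable def compA (m n d : ℕ) (P : Pol d m n) :
    Matrix (Fin (m + n*(d-1))) (Fin (n*d)) ℂ := fun i j =>
  if hi : (i : ℕ) < m then
    if hj : (j : ℕ) < n then P (Fin.last d) ⟨i, hi⟩ ⟨j, hj⟩ else 0
  else if (i : ℕ) - m = (j : ℕ) - n ∧ n ≤ (j : ℕ) then 1 else 0

/-- The constant part `B` of the first companion form: first block row
`(A_{d-1}, …, A_0)`, with `−I_n` in block entries `(i+1, i)`. -/
noncomputable def compB (m n d : ℕ) (P : Pol d m n) :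
    Matrix (Fin (m + n*(d-1))) (Fin (n*d)) ℂ := fun i j =>
  if hi : (i : ℕ) < m then
    if hn : 0 < n then
      P ⟨d - 1 - (j : ℕ) / n, Nat.lt_succ_of_le ((Nat.sub_le _ _).trans (Nat.sub_le d 1))⟩ ⟨i, hi⟩ ⟨(j : ℕ) % n, Nat.mod_lt _ hn⟩
    else 0
  else if (j : ℕ) = (i : ℕ) - m then -1 else 0

/-- The first Frobenius companion form `C¹_P` of a matrix polynomial. -/
noncomputable def comp (m n d : ℕ) (P : Pol d m n) : Pencil (m + n*(d-1)) (n*d) :=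
  (compA m n d P, compB m n d P)

/-- Strict equivalence of matrix pencils: `Q⁻¹ (λA+B) R = λC+D` for invertible `Q, R`. -/
def StrictEquiv {p q : ℕ} (L M : Pencil p q) : Prop :=
  ∃ (Q : Matrix (Fin p) (Fin p) ℂ) (R : Matrix (Fin q) (Fin q) ℂ),
    IsUnit Q ∧ IsUnit R ∧ Q⁻¹ * L.1 * R = M.1 ∧ Q⁻¹ * L.2 * R = M.2

/-- The strict equivalence orbit of a pencil. -/
def orbE {p q : ℕ} (L : Pencil p q) : Set (Pencil p q) := {M | StrictEquiv L M}

/-- The generalized Sylvester space `GSYL¹_{d,m×n}` of all first companion forms. -/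
def GSYL (m n d : ℕ) : Set (Pencil (m + n*(d-1)) (n*d)) := Set.range (comp m n d)

/-- A matrix polynomial viewed as a matrix over the field `ℂ(λ)` of rational functions. -/
noncomputable def ratMatrix {m n d : ℕ} (P : Pol d m n) :
    Matrix (Fin m) (Fin n) (RatFunc ℂ) :=
  fun i j => ∑ k : Fin (d+1), RatFunc.C (P k i j) * RatFunc.X ^ (k : ℕ)

/-- The normal rank of a matrix polynomial: its rank over `ℂ(λ)`. -/
noncomputable def nrank {m n d : ℕ} (P : Pol d m n) : ℕ := (ratMatrix P).rank

/-- Offset of the `b`-th diagonal block when block `j` has size `sz j`. -/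
def off (sz : ℕ → ℕ) (b : ℕ) : ℕ := ∑ j ∈ Finset.range b, sz j

/-- The `p × q` matrix given as a direct sum of `N` diagonal blocks, where block `b`
has size `ρ b × γ b` and entries `ent b`, blocks being laid out along the diagonal
in order (block `b` occupies rows `[off ρ b, off ρ b + ρ b)` and columns
`[off γ b, off γ b + γ b)`); all other entries are zero. -/
noncomputable def dsum (N : ℕ) (ρ γ : ℕ → ℕ) (ent : ℕ → ℕ → ℕ → ℂ) (p q : ℕ) :
    Matrix (Fin p) (Fin q) ℂ := fun x y =>
  ∑ b ∈ Finset.range N,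
    if off ρ b ≤ (x:ℕ) ∧ (x:ℕ) < off ρ b + ρ b ∧ off γ b ≤ (y:ℕ) ∧ (y:ℕ) < off γ b + γ b
    then ent b ((x:ℕ) - off ρ b) ((y:ℕ) - off γ b) else 0

/-- Sizes of the four sections of blocks: `c₁` blocks of size `v₁`, then `c₂` of size
`v₂`, then `c₃` of size `v₃`, then the rest of size `v₄`. -/
def secSize (c₁ c₂ c₃ : ℕ) (v₁ v₂ v₃ v₄ : ℕ) (i : ℕ) : ℕ :=
  if i < c₁ then v₁ else if i < c₁ + c₂ then v₂ else if i < c₁ + c₂ + c₃ then v₃ else v₄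

/-- The `p × q` pencil which is the direct sum of `c₁` copies of `L_{e₁}`, `c₂` copies
of `L_{e₂}`, `c₃` copies of `L_{f₁}ᵀ` and `c₄` copies of `L_{f₂}ᵀ`.  Here `L_k` is the
`k × (k+1)` pencil `λ G_k + F_k` with `G_k` having ones in entries `(i,i)` and `F_k`
having ones in entries `(i,i+1)`. -/
noncomputable def genPencil (c₁ c₂ c₃ c₄ e₁ e₂ f₁ f₂ p q : ℕ) : Pencil p q :=
  (dsum (c₁+c₂+c₃+c₄) (secSize c₁ c₂ c₃ e₁ e₂ (f₁+1) (f₂+1))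
     (secSize c₁ c₂ c₃ (e₁+1) (e₂+1) f₁ f₂)
     (fun _ i j => if i = j then 1 else 0) p q,
   dsum (c₁+c₂+c₃+c₄) (secSize c₁ c₂ c₃ e₁ e₂ (f₁+1) (f₂+1))
     (secSize c₁ c₂ c₃ (e₁+1) (e₂+1) f₁ f₂)
     (fun b i j => if b < c₁ + c₂ then (if j = i+1 then 1 else 0)
       else (if i = j+1 then 1 else 0)) p q)

/-- The generic pencil `G_a` of Theorem 3.2 (viewed at grade `d`):  the direct sum of
`s` copies of `L_{α+d}`, `n−r−s` copies of `L_{α+d−1}`, `t` copies of `L_{β+1}ᵀ` and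
`m−r−t` copies of `L_βᵀ`, where `α = ⌊a/(n−r)⌋`, `s = a mod (n−r)`,
`β = ⌊(rd−a)/(m−r)⌋`, `t = (rd−a) mod (m−r)`. -/
noncomputable def Ga (m n d r a : ℕ) : Pencil (m + n*(d-1)) (n*d) :=
  genPencil (a % (n-r)) (n-r - a % (n-r)) ((r*d - a) % (m-r)) (m-r - (r*d - a) % (m-r))
    (a/(n-r) + d) (a/(n-r) + d - 1) ((r*d - a)/(m-r) + 1) ((r*d - a)/(m-r))
    (m + n*(d-1)) (n*d)


/-- The generic rank-`ρ` pencil of size `p × q` with parameter `b` (Theorem 3.2 of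
De Terán–Dopico): direct sum of `s₁` copies of `L_{α₁+1}`, `q−ρ−s₁` copies of `L_{α₁}`,
`t₁` copies of `L_{β₁+1}ᵀ` and `p−ρ−t₁` copies of `L_{β₁}ᵀ`, where `α₁ = ⌊b/(q−ρ)⌋`,
`s₁ = b mod (q−ρ)`, `β₁ = ⌊(ρ−b)/(p−ρ)⌋`, `t₁ = (ρ−b) mod (p−ρ)`. -/
noncomputable def Kp (p q ρ b : ℕ) : Pencil p q :=
  genPencil (b % (q-ρ)) (q-ρ - b % (q-ρ)) ((ρ-b) % (p-ρ)) (p-ρ - (ρ-b) % (p-ρ))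
    (b/(q-ρ) + 1) (b/(q-ρ)) ((ρ-b)/(p-ρ) + 1) ((ρ-b)/(p-ρ)) p q

/-- The generic right-singular pencil `G_rp` (case `m < n`): direct sum of `s` copies of
`L_{α+d}` and `n−m−s` copies of `L_{α+d−1}`, with `α = ⌊md/(n−m)⌋`, `s = md mod (n−m)`. -/
noncomputable def Grp (m n d : ℕ) : Pencil (m + n*(d-1)) (n*d) :=
  genPencil (m*d % (n-m)) (n-m - m*d % (n-m)) 0 0
    (m*d/(n-m) + d) (m*d/(n-m) + d - 1) 0 0 (m + n*(d-1)) (n*d)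

/-- The generic left-singular pencil `G_ℓp` (case `m > n`): direct sum of `t` copies of
`L_{β+1}ᵀ` and `m−n−t` copies of `L_βᵀ`, with `β = ⌊nd/(m−n)⌋`, `t = nd mod (m−n)`. -/
noncomputable def Glp (m n d : ℕ) : Pencil (m + n*(d-1)) (n*d) :=
  genPencil 0 0 (n*d % (m-n)) (m-n - n*d % (m-n)) 0 0
    (n*d/(m-n) + 1) (n*d/(m-n)) (m + n*(d-1)) (n*d)

/-- The linear map `(X, Y) ↦ (XA − AY, XB − BY)` whose range is the tangent space at
`λA+B` to the strict equivalence orbit of the pencil `λA+B`. -/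
noncomputable def tangentMap {p q : ℕ} (L : Pencil p q) :
    (Matrix (Fin p) (Fin p) ℂ × Matrix (Fin q) (Fin q) ℂ) →ₗ[ℂ]
      (Matrix (Fin p) (Fin q) ℂ × Matrix (Fin p) (Fin q) ℂ) where
  toFun XY := (XY.1 * L.1 - L.1 * XY.2, XY.1 * L.2 - L.2 * XY.2)
  map_add' X Y := by
    obtain ⟨X₁, X₂⟩ := X; obtain ⟨Y₁, Y₂⟩ := Y
    simp only [Prod.mk_add_mk, Matrix.add_mul, Matrix.mul_add, Prod.mk.injEq]
    constructor <;> abel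
  map_smul' c X := by
    obtain ⟨X₁, X₂⟩ := X
    simp only [Prod.smul_mk, Matrix.smul_mul, Matrix.mul_smul, RingHom.id_apply,
      Prod.mk.injEq, smul_sub]

/-- The tangent space `T = {(XA − AY, XB − BY)}` at `λA+B` to its strict equivalence
orbit, as a subspace of the pencil space. -/
noncomputable def tangent {p q : ℕ} (L : Pencil p q) :
    Submodule ℂ (Matrix (Fin p) (Fin q) ℂ × Matrix (Fin p) (Fin q) ℂ) :=
  LinearMap.range (tangentMap L)

/-- The first companion form `C¹_M(λ) = λ A + B` regarded as a matrix over `ℂ[λ]`. -/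
noncomputable def compPoly (m n d : ℕ) (M : Pol d m n) :
    Matrix (Fin (m + n*(d-1))) (Fin (n*d)) (Polynomial ℂ) := fun i j =>
  Polynomial.C (compA m n d M i j) * Polynomial.X + Polynomial.C (compB m n d M i j)

/-- The block-diagonal matrix `diag(M(λ), I_{n(d−1)})` over `ℂ[λ]`. -/
noncomputable def polyBlock (m n d : ℕ) (M : Pol d m n) :
    Matrix (Fin (m + n*(d-1))) (Fin (n*d)) (Polynomial ℂ) := fun i j =>
  if hi : (i : ℕ) < m then
    if hj : (j : ℕ) < n then
      ∑ k : Fin (d+1), Polynomial.C (M k ⟨i, hi⟩ ⟨j, hj⟩) * Polynomial.X ^ (k : ℕ)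
    else 0
  else if (i : ℕ) - m = (j : ℕ) - n ∧ n ≤ (j : ℕ) then 1 else 0

/-- The first companion form regarded as a matrix over the field `ℂ(λ)`. -/
noncomputable def compRat (m n d : ℕ) (M : Pol d m n) :
    Matrix (Fin (m + n*(d-1))) (Fin (n*d)) (RatFunc ℂ) := fun i j =>
  RatFunc.C (compA m n d M i j) * RatFunc.X + RatFunc.C (compB m n d M i j)


section Helpers
attribute [local instance] Matrix.frobeniusNormedAddCommGroup Matrix.frobeniusNormedSpace

lemma fsq {ι κ : Type*} [Fintype ι] [Fintype κ] (A : Matrix ι κ ℂ) :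
    ‖A‖ ^ 2 = ∑ i, ∑ j, ‖A i j‖ ^ 2 := by
  rw [Matrix.frobenius_norm_def, ← Real.sqrt_eq_rpow, Real.sq_sqrt]
  · simp
  · positivity

lemma sum_le_of_rel {ι κ : Type*} [Fintype ι] [Fintype κ] (f : ι → ℝ) (g : κ → ℝ)
    (hg : ∀ j, 0 ≤ g j) (Rel : ι → κ → Prop)
    (h : ∀ i, f i ≠ 0 → ∃ j, Rel i j ∧ f i ≤ g j)
    (hinj : ∀ i i' j, Rel i j → Rel i' j → i = i') : ∑ i, f i ≤ ∑ j, g j := by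
  classical
  choose φ hφ hle using fun i : {i // f i ≠ 0} => h i.1 i.2
  have hi : Function.Injective φ := fun x y hxy => by
    apply Subtype.ext
    exact hinj _ _ _ (hφ x) (hxy ▸ hφ y)
  calc ∑ i, f i = ∑ i ∈ univ.filter (fun i => f i ≠ 0), f i := by
        rw [Finset.sum_filter_ne_zero]
    _ = ∑ i : {i // f i ≠ 0}, f i.1 := by
        rw [Finset.sum_subtype]; simp
    _ ≤ ∑ i : {i // f i ≠ 0}, g (φ i) := Finset.sum_le_sum fun i _ => hle i
    _ = ∑ j ∈ univ.image φ, g j := by rw [Finset.sum_image]; exact fun x _ y _ h => hi h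
    _ ≤ ∑ j, g j := Finset.sum_le_sum_of_subset_of_nonneg (subset_univ _) fun j _ _ => hg j

lemma norm_le_of_sq_le {ι κ ι' κ' : Type*} [Fintype ι] [Fintype κ] [Fintype ι'] [Fintype κ']
    (A : Matrix ι κ ℂ) (B : Matrix ι' κ' ℂ) (c : ℝ) (hc : 0 ≤ c)
    (h : ∑ i, ∑ j, ‖A i j‖ ^ 2 ≤ c ^ 2 * ∑ i, ∑ j, ‖B i j‖ ^ 2) : ‖A‖ ≤ c * ‖B‖ := by
  rw [← fsq, ← fsq, ← mul_pow] at h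
  exact (sq_le_sq₀ (by positivity) (by positivity)).mp h

lemma norm_le_of_rel {ι κ ι' κ' : Type*} [Fintype ι] [Fintype κ] [Fintype ι'] [Fintype κ']
    (A : Matrix ι κ ℂ) (B : Matrix ι' κ' ℂ) (Rel : ι × κ → ι' × κ' → Prop)
    (h : ∀ i, A i.1 i.2 ≠ 0 → ∃ j, Rel i j ∧ ‖A i.1 i.2‖ ≤ ‖B j.1 j.2‖)
    (hinj : ∀ i i' j, Rel i j → Rel i' j → i = i') : ‖A‖ ≤ ‖B‖ := by
  have := norm_le_of_sq_le A B 1 zero_le_one (by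
    rw [one_pow, one_mul, ← Fintype.sum_prod_type', ← Fintype.sum_prod_type']
    refine sum_le_of_rel _ _ (fun _ => by positivity) Rel (fun i hi => ?_) hinj
    obtain ⟨j, hj, hle⟩ := h i (by simpa using hi)
    exact ⟨j, hj, by gcongr⟩)
  simpa using this

/-- zero extension -/
noncomputable def zext {N M : ℕ} (r : Matrix (Fin N) (Fin M) ℂ) (i j : ℤ) : ℂ :=
  if h : (0 ≤ i ∧ i < N) ∧ (0 ≤ j ∧ j < M) then
    r ⟨i.toNat, by omega⟩ ⟨j.toNat, by omega⟩ else 0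

/-- right inverse on integer indices -/
noncomputable def rinv {N M : ℕ} (n d : ℕ) (r : Matrix (Fin N) (Fin M) ℂ) (a b : ℤ) : ℂ :=
  if b / n ≤ a / n then ∑ t ∈ range d, zext r (a - n - t * n) (b - t * n)
  else - ∑ t ∈ range d, zext r (a + t * n) (b + n + t * n)

lemma zext_add {N M : ℕ} (r s : Matrix (Fin N) (Fin M) ℂ) (i j : ℤ) :
    zext (r + s) i j = zext r i j + zext s i j := by
  unfold zext; split_ifs <;> simp

lemma zext_smul {N M : ℕ} (c : ℂ) (r : Matrix (Fin N) (Fin M) ℂ) (i j : ℤ) :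
    zext (c • r) i j = c * zext r i j := by
  unfold zext; split_ifs <;> simp

lemma rinv_add {N M : ℕ} (n d : ℕ) (r s : Matrix (Fin N) (Fin M) ℂ) (a b : ℤ) :
    rinv n d (r + s) a b = rinv n d r a b + rinv n d s a b := by
  unfold rinv; split_ifs <;> simp [zext_add, Finset.sum_add_distrib]; ring

lemma rinv_smul {N M : ℕ} (n d : ℕ) (c : ℂ) (r : Matrix (Fin N) (Fin M) ℂ) (a b : ℤ) :
    rinv n d (c • r) a b = c * rinv n d r a b := by
  unfold rinv; split_ifs <;> simp [zext_smul, Finset.mul_sum]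

lemma rinv_eq {N : ℕ} (n d q : ℕ) (hn : 1 ≤ n) (hq : N + n = q) (hqd : q = n * d)
    (r : Matrix (Fin N) (Fin (q + n)) ℂ) (i j : ℤ) (hi : 0 ≤ i) (hiN : i < N) :
    rinv n d r (i + n) j - rinv n d r i (j - n) = zext r i j := by
  have h1 : (i + n) / (n : ℤ) = i / n + 1 := Int.add_ediv_of_dvd_right (dvd_refl _) |>.trans (by rw [Int.ediv_self (by omega)])
  have h2 : (j - n) / (n : ℤ) = j / n - 1 := by
    rw [Int.sub_ediv_of_dvd _ (dvd_refl _), Int.ediv_self (by omega)]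
  have hc : (j - n) / (n : ℤ) ≤ i / n ↔ j / (n : ℤ) ≤ (i + n) / n := by rw [h1, h2]; omega
  have hqd' : (N : ℤ) + n = d * n := by
    have : (N : ℤ) + n = q := by exact_mod_cast hq
    rw [this, hqd]; push_cast; ring
  unfold rinv
  simp only [hc]
  split_ifs with h
  · have e : ∀ t ∈ range d, zext r (i + n - n - t * n) (j - t * n)
        - zext r (i - n - t * n) (j - n - t * n) =
        (fun t : ℕ => zext r (i - t * n) (j - t * n)) t
        - (fun t : ℕ => zext r (i - t * n) (j - t * n)) (t + 1) := by
      intro t _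
      simp only
      congr 2 <;> (try push_cast) <;> ring
    rw [← Finset.sum_sub_distrib, Finset.sum_congr rfl e, Finset.sum_range_sub']
    have : zext r (i - d * n) (j - d * n) = 0 := by
      unfold zext; rw [dif_neg]; omega
    simp [this]
  · have e : ∀ t ∈ range d, zext r (i + t * n) (j - n + n + t * n)
        - zext r (i + n + t * n) (j + n + t * n) =
        (fun t : ℕ => zext r (i + t * n) (j + t * n)) t
        - (fun t : ℕ => zext r (i + t * n) (j + t * n)) (t + 1) := by
      intro t _
      simp only
      congr 2 <;> (try push_cast) <;> ring
    rw [neg_sub_neg, ← Finset.sum_sub_distrib, Finset.sum_congr rfl e, Finset.sum_range_sub']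
    have : zext r (i + d * n) (j + d * n) = 0 := by
      unfold zext; rw [dif_neg]; omega
    simp [this]

lemma rinv_neg_col {N M : ℕ} (n d : ℕ) (hn : 1 ≤ n) (r : Matrix (Fin N) (Fin M) ℂ) (a b : ℤ)
    (ha : 0 ≤ a) (hb : b < 0) : rinv n d r a b = 0 := by
  unfold rinv
  rw [if_pos (Int.ediv_le_ediv (by omega) (by omega))]
  refine Finset.sum_eq_zero fun t _ => ?_
  unfold zext
  rw [dif_neg]
  have : (0 : ℤ) ≤ t * n := by positivity
  omega

lemma rinv_big_col {N : ℕ} (n d q : ℕ) (hn : 1 ≤ n) (hq : N + n = q) (hqd : q = n * d)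
    (r : Matrix (Fin N) (Fin (q + n)) ℂ) (a b : ℤ)
    (ha : a < q) (hb : (q : ℤ) ≤ b) : rinv n d r a b = 0 := by
  unfold rinv
  have h1 : a / (n : ℤ) < d := Int.ediv_lt_of_lt_mul (by omega) (by rw [hqd] at ha; push_cast at ha; linarith)
  have h2 : (d : ℤ) ≤ b / (n : ℤ) := Int.le_ediv_of_mul_le (by omega) (by rw [hqd] at hb; push_cast at hb; linarith)
  rw [if_neg (by omega), neg_eq_zero]
  refine Finset.sum_eq_zero fun t _ => ?_
  unfold zext
  rw [dif_neg]
  have : (0 : ℤ) ≤ t * n := by positivity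
  push_cast
  omega

/-- right inverse, as a linear map -/
noncomputable def rlin (N n d q : ℕ) :
    Matrix (Fin N) (Fin (q + n)) ℂ →ₗ[ℂ] Matrix (Fin q) (Fin q) ℂ where
  toFun r := fun a b => rinv n d r a b
  map_add' r s := by ext a b; exact rinv_add n d r s a b
  map_smul' c r := by ext a b; exact rinv_smul n d c r a b

/-- single term of the right inverse -/
noncomputable def rterm (N n q t : ℕ) (r : Matrix (Fin N) (Fin (q + n)) ℂ) :
    Matrix (Fin q) (Fin q) ℂ := fun a b =>
  if (b : ℤ) / n ≤ (a : ℤ) / n then zext r (a - n - t * n) (b - t * n)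
  else - zext r (a + t * n) (b + n + t * n)

lemma rlin_eq (N n d q : ℕ) (r : Matrix (Fin N) (Fin (q + n)) ℂ) :
    rlin N n d q r = ∑ t ∈ range d, rterm N n q t r := by
  ext a b
  simp only [Matrix.sum_apply]
  change rinv n d r a b = _
  unfold rinv rterm
  split_ifs <;> simp

lemma zext_spec {N M : ℕ} (r : Matrix (Fin N) (Fin M) ℂ) (i j : ℤ) (h : zext r i j ≠ 0) :
    ∃ p : Fin N × Fin M, (p.1 : ℤ) = i ∧ (p.2 : ℤ) = j ∧ zext r i j = r p.1 p.2 := by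
  unfold zext at h ⊢
  split_ifs at h ⊢ with h'
  · exact ⟨(⟨i.toNat, by omega⟩, ⟨j.toNat, by omega⟩), by simp; omega, by simp; omega, rfl⟩
  · simp at h

lemma rterm_norm (N n q t : ℕ) (hn : 1 ≤ n) (r : Matrix (Fin N) (Fin (q + n)) ℂ) :
    ‖rterm N n q t r‖ ≤ ‖r‖ := by
  refine norm_le_of_rel _ _ (fun x y =>
    (((x.2 : ℕ) : ℤ) / n ≤ ((x.1 : ℕ) : ℤ) / n ∧ ((y.1 : ℕ) : ℤ) = x.1 - n - t * n ∧ ((y.2 : ℕ) : ℤ) = x.2 - t * n) ∨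
    (¬ ((x.2 : ℕ) : ℤ) / n ≤ ((x.1 : ℕ) : ℤ) / n ∧ ((y.1 : ℕ) : ℤ) = x.1 + t * n ∧ ((y.2 : ℕ) : ℤ) = x.2 + n + t * n)) ?_ ?_
  · rintro ⟨a, b⟩ h
    simp only [rterm] at h ⊢
    split_ifs at h ⊢ with hc
    · obtain ⟨p, h1, h2, h3⟩ := zext_spec _ _ _ h
      exact ⟨p, Or.inl ⟨hc, h1, h2⟩, by rw [h3]⟩
    · obtain ⟨p, h1, h2, h3⟩ := zext_spec _ _ _ (neg_ne_zero.mp h)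
      exact ⟨p, Or.inr ⟨hc, h1, h2⟩, by rw [norm_neg, h3]⟩
  · have key : ∀ a b a' b' : ℤ, b / n ≤ a / n → ¬ b' / n ≤ a' / n →
        a - n - t * n = a' + t * n → b - t * n = b' + n + t * n → False := by
      intro a b a' b' h1 h2 h3 h4
      have ea : a = a' + (2 * t + 1) * n := by linarith
      have eb : b = b' + (2 * t + 1) * n := by linarith
      rw [ea, eb, Int.add_mul_ediv_right _ _ (by omega), Int.add_mul_ediv_right _ _ (by omega)] at h1
      omega
    rintro ⟨a, b⟩ ⟨a', b'⟩ ⟨i, j⟩ h h'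
    simp only at h h'
    rcases h with ⟨h1, h2, h3⟩ | ⟨h1, h2, h3⟩ <;> rcases h' with ⟨h1', h2', h3'⟩ | ⟨h1', h2', h3'⟩
    · ext <;> simp <;> omega
    · exact (key _ _ _ _ h1 h1' (h2.symm.trans h2') (h3.symm.trans h3')).elim
    · exact (key _ _ _ _ h1' h1 (h2'.symm.trans h2) (h3'.symm.trans h3)).elim
    · ext <;> simp <;> omega

lemma rlin_norm (N n d q : ℕ) (hn : 1 ≤ n) (r : Matrix (Fin N) (Fin (q + n)) ℂ) :
    ‖rlin N n d q r‖ ≤ d * ‖r‖ := by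
  rw [rlin_eq]
  refine (norm_sum_le _ _).trans ?_
  refine (Finset.sum_le_sum fun t _ => rterm_norm N n q t hn r).trans ?_
  simp

lemma exists_fix {Y : Type*} [NormedAddCommGroup Y] [NormedSpace ℂ Y] [FiniteDimensional ℂ Y]
    (f : Y →ₗ[ℂ] Y) (θ : ℝ) (hθ : θ < 1) (hf : ∀ y, ‖f y‖ ≤ θ * ‖y‖) (z : Y) :
    ∃ y, y + f y = z ∧ (1 - θ) * ‖y‖ ≤ ‖z‖ := by
  have hb : ∀ y, (1 - θ) * ‖y‖ ≤ ‖y + f y‖ := fun y => by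
    have h1 : ‖y‖ ≤ ‖y + f y‖ + ‖f y‖ := by
      simpa using norm_sub_le (y + f y) (f y)
    nlinarith [hf y]
  have hinj : Function.Injective ((LinearMap.id : Y →ₗ[ℂ] Y) + f) := by
    rw [← LinearMap.ker_eq_bot, LinearMap.ker_eq_bot']
    intro y hy
    have h0 : y + f y = 0 := hy
    have := hb y
    rw [h0, norm_zero] at this
    have h2 : ‖y‖ ≤ 0 := by
      by_contra hc
      push Not at hc
      nlinarith
    exact norm_le_zero_iff.mp h2
  obtain ⟨y, hy⟩ := LinearMap.surjective_of_injective hinj z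
  exact ⟨y, hy, hy ▸ hb y⟩

lemma isUnit_of_close {q : ℕ} (V : Matrix (Fin q) (Fin q) ℂ) (h : ‖V - 1‖ < 1) : IsUnit V := by
  rcases Nat.eq_zero_or_pos q with rfl | hq
  · exact isUnit_of_subsingleton V
  rw [Matrix.isUnit_iff_isUnit_det, isUnit_iff_ne_zero]
  intro hdet
  obtain ⟨v, hv, hv0⟩ := Matrix.exists_mulVec_eq_zero_iff.mpr hdet
  have e : V * Matrix.replicateCol Unit v = 0 := by
    ext i j
    exact congrFun hv0 i
  have e2 : (V - 1) * Matrix.replicateCol Unit v = - Matrix.replicateCol Unit v := by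
    rw [Matrix.sub_mul, e]; simp
  have := Matrix.frobenius_norm_mul (V - 1) (Matrix.replicateCol Unit v)
  rw [e2, norm_neg] at this
  have h0 : 0 < ‖Matrix.replicateCol Unit v‖ := by
    rw [norm_pos_iff]
    intro h0
    apply hv
    ext i
    exact congrFun (congrFun h0 i) ()
  nlinarith


/-- block shift -/
noncomputable def Em (N n q : ℕ) : Matrix (Fin N) (Fin q) ℂ :=
  fun i j => if (j : ℕ) = i + n then 1 else 0

/-- truncated identity -/
noncomputable def Fm (N q : ℕ) : Matrix (Fin N) (Fin q) ℂ :=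
  fun i j => if (j : ℕ) = i then 1 else 0

lemma sum_ite_fin {q : ℕ} (k : ℕ) (f : Fin q → ℂ) :
    (∑ x : Fin q, (if (x : ℕ) = k then f x else 0)) = if h : k < q then f ⟨k, h⟩ else 0 := by
  split_ifs with h
  · rw [Finset.sum_eq_single ⟨k, h⟩]
    · simp
    · intro b _ hb
      rw [if_neg]
      intro e
      exact hb (Fin.ext e)
    · simp
  · refine Finset.sum_eq_zero fun x _ => ?_
    rw [if_neg]
    omega

lemma Em_mul {N n q r : ℕ} (hq : N + n = q) (X : Matrix (Fin q) (Fin r) ℂ) (i : Fin N) (j : Fin r) :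
    (Em N n q * X) i j = X ⟨i + n, by omega⟩ j := by
  simp only [Matrix.mul_apply, Em, ite_mul, one_mul, zero_mul]
  rw [sum_ite_fin, dif_pos]

lemma Fm_mul {N n q r : ℕ} (hq : N + n = q) (X : Matrix (Fin q) (Fin r) ℂ) (i : Fin N) (j : Fin r) :
    (Fm N q * X) i j = X ⟨i, by omega⟩ j := by
  simp only [Matrix.mul_apply, Fm, ite_mul, one_mul, zero_mul]
  rw [sum_ite_fin, dif_pos]

lemma mul_Em {N n q r : ℕ} (hq : N + n = q) (X : Matrix (Fin r) (Fin N) ℂ) (i : Fin r) (j : Fin q) :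
    (X * Em N n q) i j = if h : n ≤ (j : ℕ) then X i ⟨j - n, by omega⟩ else 0 := by
  simp only [Matrix.mul_apply, Em, mul_ite, mul_one, mul_zero]
  by_cases h : n ≤ (j : ℕ)
  · have : ∀ x : Fin N, ((j : ℕ) = x + n) = ((x : ℕ) = j - n) := fun x => by
      apply propext; omega
    simp only [this]
    rw [sum_ite_fin, dif_pos h, dif_pos]
  · rw [dif_neg h]
    refine Finset.sum_eq_zero fun x _ => ?_
    rw [if_neg]
    omega

lemma mul_Fm {N q r : ℕ} (X : Matrix (Fin r) (Fin N) ℂ) (i : Fin r) (j : Fin q) :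
    (X * Fm N q) i j = if h : (j : ℕ) < N then X i ⟨j, h⟩ else 0 := by
  simp only [Matrix.mul_apply, Fm, mul_ite, mul_one, mul_zero]
  have : ∀ x : Fin N, ((j : ℕ) = x) = ((x : ℕ) = j) := fun x => by
    apply propext; omega
  simp only [this]
  rw [sum_ite_fin]

/-- pad columns on the right -/
noncomputable def padL (N q n : ℕ) : Matrix (Fin N) (Fin q) ℂ →ₗ[ℂ] Matrix (Fin N) (Fin (q + n)) ℂ where
  toFun Z := Matrix.of fun i j => if h : (j : ℕ) < q then Z i ⟨j, h⟩ else 0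
  map_add' r s := by ext a b; simp only [Matrix.add_apply, Matrix.of_apply]; split_ifs <;> simp
  map_smul' c r := by
    ext a b; simp only [Matrix.smul_apply, Matrix.of_apply, RingHom.id_apply]; split_ifs <;> simp

/-- pad columns on the left -/
noncomputable def padR (N q n : ℕ) : Matrix (Fin N) (Fin q) ℂ →ₗ[ℂ] Matrix (Fin N) (Fin (q + n)) ℂ where
  toFun Z := Matrix.of fun i j => if h : n ≤ (j : ℕ) then Z i ⟨j - n, by omega⟩ else 0
  map_add' r s := by ext a b; simp only [Matrix.add_apply, Matrix.of_apply]; split_ifs <;> simp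
  map_smul' c r := by
    ext a b; simp only [Matrix.smul_apply, Matrix.of_apply, RingHom.id_apply]; split_ifs <;> simp

lemma padL_apply {N q n : ℕ} (Z : Matrix (Fin N) (Fin q) ℂ) (i : Fin N) (j : Fin (q + n)) :
    padL N q n Z i j = if h : (j : ℕ) < q then Z i ⟨j, h⟩ else 0 := rfl

lemma padR_apply {N q n : ℕ} (Z : Matrix (Fin N) (Fin q) ℂ) (i : Fin N) (j : Fin (q + n)) :
    padR N q n Z i j = if h : n ≤ (j : ℕ) then Z i ⟨j - n, by omega⟩ else 0 := rfl

lemma padL_norm {N q n : ℕ} (Z : Matrix (Fin N) (Fin q) ℂ) : ‖padL N q n Z‖ ≤ ‖Z‖ := by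
  refine norm_le_of_rel _ _ (fun x y => x.1 = y.1 ∧ (x.2 : ℕ) = y.2) ?_ ?_
  · rintro ⟨i, j⟩ h
    simp only [padL_apply] at h ⊢
    split_ifs at h ⊢ with hj
    · exact ⟨(i, ⟨j, hj⟩), ⟨rfl, rfl⟩, le_rfl⟩
    · simp at h
  · rintro ⟨i, j⟩ ⟨i', j'⟩ ⟨a, b⟩ ⟨h1, h2⟩ ⟨h3, h4⟩
    simp only at h1 h2 h3 h4
    ext <;> simp <;> omega

lemma padR_norm {N q n : ℕ} (Z : Matrix (Fin N) (Fin q) ℂ) : ‖padR N q n Z‖ ≤ ‖Z‖ := by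
  refine norm_le_of_rel _ _ (fun x y => x.1 = y.1 ∧ (x.2 : ℕ) = y.2 + n) ?_ ?_
  · rintro ⟨i, j⟩ h
    simp only [padR_apply] at h ⊢
    split_ifs at h ⊢ with hj
    · exact ⟨(i, ⟨j - n, by omega⟩), ⟨rfl, by simp; omega⟩, le_rfl⟩
    · simp at h
  · rintro ⟨i, j⟩ ⟨i', j'⟩ ⟨a, b⟩ ⟨h1, h2⟩ ⟨h3, h4⟩
    simp only at h1 h2 h3 h4
    ext <;> simp <;> omega

lemma rlin_spec {N : ℕ} (n d q : ℕ) (hn : 1 ≤ n) (hq : N + n = q) (hqd : q = n * d)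
    (r : Matrix (Fin N) (Fin (q + n)) ℂ) :
    padL N q n (Em N n q * rlin N n d q r) - padR N q n (Fm N q * rlin N n d q r) = r := by
  ext i j
  have h1 : padL N q n (Em N n q * rlin N n d q r) i j = rinv n d r ((i : ℕ) + n) (j : ℕ) := by
    rw [padL_apply]
    split_ifs with h
    · rw [Em_mul hq]
      change rinv n d r _ _ = _
      simp
    · exact (rinv_big_col n d q hn hq hqd r _ _ (by omega) (by omega)).symm
  have h2 : padR N q n (Fm N q * rlin N n d q r) i j = rinv n d r (i : ℕ) ((j : ℕ) - n) := by
    rw [padR_apply]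
    split_ifs with h
    · rw [Fm_mul hq]
      change rinv n d r _ _ = _
      simp [h]
    · exact (rinv_neg_col n d hn r _ _ (by omega) (by omega)).symm
  rw [Matrix.sub_apply, h1, h2, rinv_eq n d q hn hq hqd r _ _ (by omega) (by omega)]
  unfold zext
  rw [dif_pos (by omega)]
  simp

lemma core {N : ℕ} (n d q : ℕ) (hn : 1 ≤ n) (hq : N + n = q) (hqd : q = n * d)
    (DE DF : Matrix (Fin N) (Fin q) ℂ) (θ : ℝ) (hθ : d * (‖DE‖ + ‖DF‖) ≤ θ) (hθ1 : θ < 1) :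
    ∃ (V : Matrix (Fin q) (Fin q) ℂ) (W : Matrix (Fin N) (Fin N) ℂ),
      (Em N n q + DE) * V = W * Em N n q ∧ (Fm N q + DF) * V = W * Fm N q ∧
      (1 - θ) * ‖V - 1‖ ≤ d * (‖DE‖ + ‖DF‖) ∧
      ‖W - 1‖ ≤ ‖V - 1‖ + ‖DF‖ * (1 + ‖V - 1‖) := by
  let mulL (D : Matrix (Fin N) (Fin q) ℂ) :
      Matrix (Fin q) (Fin q) ℂ →ₗ[ℂ] Matrix (Fin N) (Fin q) ℂ :=
    { toFun := fun X => D * X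
      map_add' := fun X Y => Matrix.mul_add _ _ _
      map_smul' := fun c X => by simp }
  let f : Matrix (Fin N) (Fin (q + n)) ℂ →ₗ[ℂ] Matrix (Fin N) (Fin (q + n)) ℂ :=
    (padL N q n ∘ₗ mulL DE - padR N q n ∘ₗ mulL DF) ∘ₗ rlin N n d q
  have hfe : ∀ y, f y = padL N q n (DE * rlin N n d q y) - padR N q n (DF * rlin N n d q y) :=
    fun y => rfl
  have hf : ∀ y, ‖f y‖ ≤ θ * ‖y‖ := by
    intro y
    rw [hfe]
    have h1 := (padL_norm (n := n) (DE * rlin N n d q y)).trans (Matrix.frobenius_norm_mul _ _)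
    have h2 := (padR_norm (n := n) (DF * rlin N n d q y)).trans (Matrix.frobenius_norm_mul _ _)
    have h3 := rlin_norm N n d q hn y
    calc _ ≤ ‖DE‖ * ‖rlin N n d q y‖ + ‖DF‖ * ‖rlin N n d q y‖ :=
          (norm_sub_le _ _).trans (add_le_add h1 h2)
      _ = (‖DE‖ + ‖DF‖) * ‖rlin N n d q y‖ := by ring
      _ ≤ (‖DE‖ + ‖DF‖) * (d * ‖y‖) := by gcongr
      _ = (d * (‖DE‖ + ‖DF‖)) * ‖y‖ := by ring
      _ ≤ _ := by gcongr
  obtain ⟨y, hy, hyn⟩ := exists_fix f θ hθ1 hf (-(padL N q n DE - padR N q n DF))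
  have hz : ‖-(padL N q n DE - padR N q n DF)‖ ≤ ‖DE‖ + ‖DF‖ := by
    rw [norm_neg]
    exact (norm_sub_le _ _).trans (add_le_add (padL_norm _) (padR_norm _))
  set X := rlin N n d q y with hX
  have hspec := rlin_spec n d q hn hq hqd y
  rw [← hX] at hspec
  have hEF : padL N q n (Em N n q) - padR N q n (Fm N q) = 0 := by
    ext i j
    simp only [Matrix.sub_apply, padL_apply, padR_apply, Em, Fm, Matrix.zero_apply]
    split_ifs <;> first | omega | simp
  have hmain : padL N q n ((Em N n q + DE) * (1 + X)) = padR N q n ((Fm N q + DF) * (1 + X)) := by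
    rw [← sub_eq_zero]
    simp only [Matrix.add_mul, Matrix.mul_add, Matrix.mul_one, map_add]
    rw [hfe, ← hX] at hy
    have hy' : y + (padL N q n (DE * X) - padR N q n (DF * X)) + (padL N q n DE - padR N q n DF) = 0 := by
      rw [hy]; simp
    rw [← hspec] at hy'
    calc _ = (padL N q n (Em N n q) - padR N q n (Fm N q)) +
        (padL N q n (Em N n q * X) - padR N q n (Fm N q * X) +
          (padL N q n (DE * X) - padR N q n (DF * X)) + (padL N q n DE - padR N q n DF)) := by abel
      _ = 0 := by rw [hEF, hy', add_zero]
  have hm : ∀ (i : Fin N) (j : Fin (q + n)), _ := fun i j => congrFun (congrFun hmain i) j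
  simp only [padL_apply, padR_apply] at hm
  let W : Matrix (Fin N) (Fin N) ℂ :=
    Matrix.of fun i k => ((Fm N q + DF) * (1 + X) : Matrix (Fin N) (Fin q) ℂ) i ⟨k, by omega⟩
  refine ⟨1 + X, W, ?_, ?_, ?_, ?_⟩
  · ext i j
    rw [mul_Em hq]
    have := hm i ⟨j, by omega⟩
    simp only [Fin.is_lt, dite_true, Fin.eta] at this
    rw [this]
    rfl
  · ext i j
    rw [mul_Fm]
    split_ifs with h
    · rfl
    · have := hm i ⟨j + n, by omega⟩
      rw [dif_neg (by simp; omega), dif_pos (by simp)] at this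
      simpa using this.symm
  · rw [add_sub_cancel_left]
    have h3 := rlin_norm N n d q hn y
    rw [← hX] at h3
    have h4 : (1 - θ) * ‖X‖ ≤ (1 - θ) * (d * ‖y‖) := by
      apply mul_le_mul_of_nonneg_left h3; linarith
    have h5 : (d : ℝ) * ((1 - θ) * ‖y‖) ≤ d * (‖DE‖ + ‖DF‖) :=
      mul_le_mul_of_nonneg_left (hyn.trans hz) (by positivity)
    linarith
  · rw [add_sub_cancel_left]
    let W1 : Matrix (Fin N) (Fin N) ℂ := Matrix.of fun i k => X ⟨i, by omega⟩ ⟨k, by omega⟩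
    let W2 : Matrix (Fin N) (Fin N) ℂ := Matrix.of fun i k => (DF + DF * X) i ⟨k, by omega⟩
    have e : W - 1 = W1 + W2 := by
      ext i k
      have : (Fm N q) i ⟨k, by omega⟩ = (1 : Matrix (Fin N) (Fin N) ℂ) i k := by
        simp [Fm, Matrix.one_apply, Fin.ext_iff, eq_comm]
      simp only [W, W1, W2, Matrix.of_apply, Matrix.sub_apply, Matrix.add_apply, Matrix.add_mul, Matrix.mul_add,
        Matrix.mul_one, Fm_mul hq, this]
      ring
    have n1 : ‖W1‖ ≤ ‖X‖ := by
      refine norm_le_of_rel _ _ (fun x y => (x.1 : ℕ) = y.1 ∧ (x.2 : ℕ) = y.2) ?_ ?_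
      · rintro ⟨i, j⟩ h
        exact ⟨(⟨i, by omega⟩, ⟨j, by omega⟩), ⟨rfl, rfl⟩, le_rfl⟩
      · rintro ⟨i, j⟩ ⟨i', j'⟩ ⟨a, b⟩ ⟨h1, h2⟩ ⟨h3, h4⟩
        simp only at h1 h2 h3 h4
        ext <;> simp <;> omega
    have n2 : ‖W2‖ ≤ ‖DF + DF * X‖ := by
      refine norm_le_of_rel _ _ (fun x y => x.1 = y.1 ∧ (x.2 : ℕ) = y.2) ?_ ?_
      · rintro ⟨i, j⟩ h
        exact ⟨(i, ⟨j, by omega⟩), ⟨rfl, rfl⟩, le_rfl⟩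
      · rintro ⟨i, j⟩ ⟨i', j'⟩ ⟨a, b⟩ ⟨h1, h2⟩ ⟨h3, h4⟩
        simp only at h1 h2 h3 h4
        ext <;> simp <;> omega
    have n3 : ‖DF + DF * X‖ ≤ ‖DF‖ + ‖DF‖ * ‖X‖ :=
      (norm_add_le _ _).trans (add_le_add le_rfl (Matrix.frobenius_norm_mul _ _))
    rw [e]
    have := norm_add_le W1 W2
    linarith

/-- top block rows -/
def topR {m N q : ℕ} (M : Matrix (Fin (m + N)) (Fin q) ℂ) : Matrix (Fin m) (Fin q) ℂ :=
  Matrix.of fun i j => M (Fin.castAdd N i) j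

/-- bottom block rows -/
def botR {m N q : ℕ} (M : Matrix (Fin (m + N)) (Fin q) ℂ) : Matrix (Fin N) (Fin q) ℂ :=
  Matrix.of fun i j => M (Fin.natAdd m i) j

lemma norm_top_bot {m N q : ℕ} (M : Matrix (Fin (m + N)) (Fin q) ℂ) :
    ‖M‖ ^ 2 = ‖topR M‖ ^ 2 + ‖botR M‖ ^ 2 := by
  simp only [fsq, topR, botR, Matrix.of_apply]
  rw [Fin.sum_univ_add]

lemma penDist_sq {p q : ℕ} (L L' : Pencil p q) :
    penDist L L' ^ 2 = ‖L.1 - L'.1‖ ^ 2 + ‖L.2 - L'.2‖ ^ 2 := by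
  unfold penDist
  rw [Real.sq_sqrt (by positivity)]
  simp only [fsq, Matrix.sub_apply]

lemma polNorm_sq {m n d : ℕ} (P : Pol d m n) :
    polNorm P ^ 2 = ∑ k, ∑ i, ∑ j, ‖P k i j‖ ^ 2 := by
  unfold polNorm
  rw [Real.sq_sqrt (by positivity)]

lemma botR_compA (m n d : ℕ) (P : Pol d m n) :
    botR (compA m n d P) = Em (n * (d - 1)) n (n * d) := by
  ext i j
  simp only [botR, compA, Em, Matrix.of_apply, Fin.val_natAdd]
  rw [dif_neg (by omega)]
  congr 1
  apply propext
  omega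

lemma botR_compB (m n d : ℕ) (P : Pol d m n) :
    botR (compB m n d P) = - Fm (n * (d - 1)) (n * d) := by
  ext i j
  simp only [botR, compB, Fm, Matrix.of_apply, Fin.val_natAdd, Matrix.neg_apply]
  rw [dif_neg (by omega)]
  simp only [Nat.add_sub_cancel_left]
  split_ifs <;> simp

/-- extension by zero in columns -/
noncomputable def xe {m q : ℕ} (X : Matrix (Fin m) (Fin q) ℂ) (i : Fin m) (j : ℕ) : ℂ :=
  if h : j < q then X i ⟨j, h⟩ else 0

lemma xe_fin {m q : ℕ} (X : Matrix (Fin m) (Fin q) ℂ) (i : Fin m) (j : Fin q) :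
    xe X i j = X i j := by simp [xe]

/-- the polynomial read off from the top pencil -/
noncomputable def mkPol (m n d : ℕ) (X Y : Matrix (Fin m) (Fin (n * d)) ℂ) : Pol d m n :=
  fun k => Matrix.of fun i a => if (k : ℕ) = d then xe X i a else
    xe Y i ((d - 1 - k) * n + a) + xe X i ((d - 1 - k) * n + a + n)

lemma topR_compA_mk (m n d : ℕ) (X Y : Matrix (Fin m) (Fin (n * d)) ℂ) (i : Fin m)
    (j : Fin (n * d)) :
    topR (compA m n d (mkPol m n d X Y)) i j = if (j : ℕ) < n then X i j else 0 := by
  simp only [topR, compA, mkPol, Matrix.of_apply, Fin.val_castAdd, Fin.is_lt,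
    Fin.val_last, if_true, xe_fin, Fin.eta, dite_eq_ite]

lemma topR_compB_mk (m n d : ℕ) (hn : 1 ≤ n) (hd : 1 ≤ d) (X Y : Matrix (Fin m) (Fin (n * d)) ℂ)
    (i : Fin m) (j : Fin (n * d)) :
    topR (compB m n d (mkPol m n d X Y)) i j = Y i j + xe X i (j + n) := by
  have h1 : (j : ℕ) / n < d := Nat.div_lt_of_lt_mul j.2
  have h2 : d - 1 - (d - 1 - (j : ℕ) / n) = (j : ℕ) / n :=
    Nat.sub_sub_self (Nat.le_sub_one_of_lt h1)
  have h3 : (j : ℕ) / n * n + (j : ℕ) % n = j := Nat.div_add_mod' _ _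
  simp only [topR, compB, mkPol, Matrix.of_apply, Fin.val_castAdd, Fin.is_lt, dite_true, Fin.eta]
  have h4 : ∀ x : ℕ, ¬ d - 1 - x = d := fun x => by omega
  rw [dif_pos (by omega), if_neg (h4 _), h2, h3, xe_fin]

lemma topR_compA_zero (m n d : ℕ) (P : Pol d m n) (i : Fin m) (j : Fin (n * d)) (h : n ≤ (j : ℕ)) :
    topR (compA m n d P) i j = 0 := by
  simp only [topR, compA, Matrix.of_apply, Fin.val_castAdd, Fin.is_lt, dite_true]
  rw [dif_neg (by omega)]

lemma top_le_polNorm (m n d : ℕ) (hn : 1 ≤ n) (hd : 1 ≤ d) (P : Pol d m n) :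
    ‖topR (compA m n d P)‖ ^ 2 + ‖topR (compB m n d P)‖ ^ 2 ≤ polNorm P ^ 2 := by
  have e : ∑ k, ∑ i, ∑ j, ‖P k i j‖ ^ 2 =
      ∑ x : Fin (d + 1) × Fin m × Fin n, ‖P x.1 x.2.1 x.2.2‖ ^ 2 := by
    simp only [Fintype.sum_prod_type]
  rw [polNorm_sq, e, fsq, fsq]
  have e2 : ∀ A : Matrix (Fin m) (Fin (n * d)) ℂ, ∑ i, ∑ j, ‖A i j‖ ^ 2 =
      ∑ x : Fin m × Fin (n * d), ‖A x.1 x.2‖ ^ 2 := fun A => by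
    simp only [Fintype.sum_prod_type]
  rw [e2, e2]
  have := sum_le_of_rel (Sum.elim
      (fun x : Fin m × Fin (n * d) => ‖topR (compA m n d P) x.1 x.2‖ ^ 2)
      (fun x : Fin m × Fin (n * d) => ‖topR (compB m n d P) x.1 x.2‖ ^ 2))
    (fun x : Fin (d + 1) × Fin m × Fin n => ‖P x.1 x.2.1 x.2.2‖ ^ 2)
    (fun _ => by positivity)
    (fun x y => Sum.elim
      (fun x => (y.1 : ℕ) = d ∧ y.2.1 = x.1 ∧ (y.2.2 : ℕ) = x.2)
      (fun x => (y.1 : ℕ) = d - 1 - (x.2 : ℕ) / n ∧ y.2.1 = x.1 ∧ (y.2.2 : ℕ) = (x.2 : ℕ) % n) x)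
    ?_ ?_
  · rw [Fintype.sum_sum_type] at this
    exact this
  · rintro (⟨i, j⟩ | ⟨i, j⟩) h
    · by_cases hj : n ≤ (j : ℕ)
      · simp [topR_compA_zero _ _ _ _ _ _ hj] at h
      · refine ⟨(Fin.last d, i, ⟨j, by omega⟩), ⟨by simp, rfl, rfl⟩, ?_⟩
        simp only [Sum.elim_inl, topR, compA, Matrix.of_apply, Fin.val_castAdd, Fin.is_lt, dite_true,
          Fin.eta]
        rw [dif_pos (by omega)]
    · refine ⟨(⟨d - 1 - (j : ℕ) / n,
        Nat.lt_succ_of_le ((Nat.sub_le _ _).trans (Nat.sub_le d 1))⟩, i, ⟨(j : ℕ) % n, Nat.mod_lt _ hn⟩),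
        ⟨rfl, rfl, rfl⟩, ?_⟩
      simp only [Sum.elim_inr, topR, compB, Matrix.of_apply, Fin.val_castAdd, Fin.is_lt, dite_true,
          Fin.eta]
      rw [dif_pos (by omega)]
  · have h4 : ∀ x : ℕ, ¬ d - 1 - x = d := fun x => by omega
    have hdiv : ∀ j : Fin (n * d), (j : ℕ) / n < d := fun j => Nat.div_lt_of_lt_mul j.2
    rintro (⟨i, j⟩ | ⟨i, j⟩) (⟨i', j'⟩ | ⟨i', j'⟩) ⟨k, a, b⟩ h h'
    · simp only [Sum.elim_inl] at h h'
      obtain ⟨h1, h2, h3⟩ := h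
      obtain ⟨h1', h2', h3'⟩ := h'
      congr 2
      · rw [← h2, ← h2']
      · exact Fin.ext (by omega)
    · simp only [Sum.elim_inl, Sum.elim_inr] at h h'
      exact (h4 _ (h'.1.symm.trans h.1)).elim
    · simp only [Sum.elim_inl, Sum.elim_inr] at h h'
      exact (h4 _ (h.1.symm.trans h'.1)).elim
    · simp only [Sum.elim_inr] at h h'
      obtain ⟨h1, h2, h3⟩ := h
      obtain ⟨h1', h2', h3'⟩ := h'
      congr 2
      · rw [← h2, ← h2']
      · have q1 := hdiv j
        have q2 := hdiv j'
        have q3 : (j : ℕ) / n = (j' : ℕ) / n := by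
          rw [h1] at h1'
          generalize (j : ℕ) / n = u at *
          generalize (j' : ℕ) / n = v at *
          omega
        have q4 : (j : ℕ) % n = (j' : ℕ) % n := h3.symm.trans h3'
        apply Fin.ext
        rw [← Nat.div_add_mod (j : ℕ) n, ← Nat.div_add_mod (j' : ℕ) n, q3, q4]

lemma shift_norm {m n q : ℕ} (G : Matrix (Fin m) (Fin q) ℂ) :
    ‖(Matrix.of fun i j => if (j : ℕ) < n then G i j else 0 : Matrix (Fin m) (Fin q) ℂ)‖ ^ 2
      + ‖(Matrix.of fun i j => xe G i (j + n) : Matrix (Fin m) (Fin q) ℂ)‖ ^ 2 ≤ ‖G‖ ^ 2 := by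
  rw [fsq, fsq, fsq]
  rw [← Finset.sum_add_distrib]
  refine Finset.sum_le_sum fun i _ => ?_
  simp only [Matrix.of_apply]
  have := sum_le_of_rel (Sum.elim
      (fun j : Fin q => ‖(if (j : ℕ) < n then G i j else 0)‖ ^ 2)
      (fun j : Fin q => ‖xe G i (j + n)‖ ^ 2))
    (fun j : Fin q => ‖G i j‖ ^ 2)
    (fun _ => by positivity)
    (fun x y => Sum.elim
      (fun x : Fin q => (x : ℕ) < n ∧ (y : ℕ) = x)
      (fun x : Fin q => (y : ℕ) = x + n) x)
    ?_ ?_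
  · rw [Fintype.sum_sum_type] at this
    exact this
  · rintro (j | j) h
    · simp only [Sum.elim_inl] at h ⊢
      split_ifs at h ⊢ with hj
      · exact ⟨j, ⟨hj, rfl⟩, le_rfl⟩
      · simp at h
    · simp only [Sum.elim_inr, xe] at h ⊢
      split_ifs at h ⊢ with hj
      · exact ⟨⟨j + n, hj⟩, rfl, le_rfl⟩
      · simp at h
  · rintro (j | j) (j' | j') k h h' <;> simp only [Sum.elim_inl, Sum.elim_inr] at h h'
    · congr 1; exact Fin.ext (by omega)
    · omega
    · omega
    · congr 1; exact Fin.ext (by omega)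

/-- distance between a companion form and the one read off from a top pencil -/
lemma dist_mk (m n d : ℕ) (hn : 1 ≤ n) (hd : 1 ≤ d) (P : Pol d m n)
    (X Y : Matrix (Fin m) (Fin (n * d)) ℂ) :
    penDist (comp m n d P) (comp m n d (mkPol m n d X Y)) ^ 2 ≤
      2 * (‖X - topR (compA m n d P)‖ ^ 2 + ‖Y - topR (compB m n d P)‖ ^ 2) := by
  rw [penDist_sq, norm_top_bot, norm_top_bot]
  simp only [comp]
  have b1 : botR (compA m n d P - compA m n d (mkPol m n d X Y)) = 0 := by
    have : botR (compA m n d P - compA m n d (mkPol m n d X Y)) =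
      botR (compA m n d P) - botR (compA m n d (mkPol m n d X Y)) := rfl
    rw [this, botR_compA, botR_compA, sub_self]
  have b2 : botR (compB m n d P - compB m n d (mkPol m n d X Y)) = 0 := by
    have : botR (compB m n d P - compB m n d (mkPol m n d X Y)) =
      botR (compB m n d P) - botR (compB m n d (mkPol m n d X Y)) := rfl
    rw [this, botR_compB, botR_compB, sub_self]
  set G1 := X - topR (compA m n d P) with hG1
  set G0 := Y - topR (compB m n d P) with hG0
  set D : Matrix (Fin m) (Fin (n * d)) ℂ := Matrix.of fun i j => if (j : ℕ) < n then G1 i j else 0 with hD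
  set S : Matrix (Fin m) (Fin (n * d)) ℂ := Matrix.of fun i j => xe G1 i (j + n) with hS
  have t1 : topR (compA m n d P - compA m n d (mkPol m n d X Y)) = - D := by
    ext i j
    have : topR (compA m n d P - compA m n d (mkPol m n d X Y)) i j =
      topR (compA m n d P) i j - topR (compA m n d (mkPol m n d X Y)) i j := rfl
    rw [this, topR_compA_mk, hD, hG1]
    simp only [Matrix.neg_apply, Matrix.of_apply, Matrix.sub_apply]
    split_ifs with h
    · ring
    · rw [topR_compA_zero _ _ _ _ _ _ (by omega)]; simp
  have t2 : topR (compB m n d P - compB m n d (mkPol m n d X Y)) = - (G0 + S) := by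
    ext i j
    have : topR (compB m n d P - compB m n d (mkPol m n d X Y)) i j =
      topR (compB m n d P) i j - topR (compB m n d (mkPol m n d X Y)) i j := rfl
    rw [this, topR_compB_mk _ _ _ hn hd, hS, hG1, hG0]
    simp only [Matrix.neg_apply, Matrix.of_apply, Matrix.sub_apply, Matrix.add_apply]
    have : xe (X - topR (compA m n d P)) i (j + n) = xe X i (j + n) := by
      unfold xe
      split_ifs with h
      · rw [Matrix.sub_apply, topR_compA_zero _ _ _ _ _ _ (by simp), sub_zero]
      · rfl
    rw [this]; ring
  rw [b1, b2, t1, t2, norm_neg, norm_neg, norm_zero]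
  have h1 : ‖D‖ ^ 2 + ‖S‖ ^ 2 ≤ ‖G1‖ ^ 2 := shift_norm G1
  have h2 := norm_add_le G0 S
  have h3 : ‖G0 + S‖ ^ 2 ≤ (‖G0‖ + ‖S‖) ^ 2 := by gcongr
  nlinarith [sq_nonneg (‖G0‖ - ‖S‖), sq_nonneg ‖D‖]

lemma topR_mul {m N q r : ℕ} (M : Matrix (Fin (m + N)) (Fin q) ℂ) (V : Matrix (Fin q) (Fin r) ℂ) :
    topR (M * V) = topR M * V := by
  ext i j; simp [topR, Matrix.mul_apply]

lemma botR_mul {m N q r : ℕ} (M : Matrix (Fin (m + N)) (Fin q) ℂ) (V : Matrix (Fin q) (Fin r) ℂ) :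
    botR (M * V) = botR M * V := by
  ext i j; simp [botR, Matrix.mul_apply]

lemma ext_top_bot {m N q : ℕ} (M M' : Matrix (Fin (m + N)) (Fin q) ℂ)
    (h1 : topR M = topR M') (h2 : botR M = botR M') : M = M' := by
  ext i j
  refine Fin.addCases (fun i => ?_) (fun i => ?_) i
  · exact congrFun (congrFun h1 i) j
  · exact congrFun (congrFun h2 i) j

/-- block upper triangular transformation -/
def Qm {m N : ℕ} (C : Matrix (Fin m) (Fin N) ℂ) (W : Matrix (Fin N) (Fin N) ℂ) :
    Matrix (Fin (m + N)) (Fin (m + N)) ℂ :=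
  (Matrix.fromBlocks 1 C 0 W).submatrix finSumFinEquiv.symm finSumFinEquiv.symm

lemma Qm_isUnit {m N : ℕ} (C : Matrix (Fin m) (Fin N) ℂ) (W : Matrix (Fin N) (Fin N) ℂ)
    (hW : IsUnit W) : IsUnit (Qm C W) := by
  rw [Matrix.isUnit_iff_isUnit_det] at hW ⊢
  unfold Qm
  rw [Matrix.det_submatrix_equiv_self, Matrix.det_fromBlocks_zero₂₁]
  simpa using hW

lemma topR_Qm {m N q : ℕ} (C : Matrix (Fin m) (Fin N) ℂ) (W : Matrix (Fin N) (Fin N) ℂ)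
    (M : Matrix (Fin (m + N)) (Fin q) ℂ) : topR (Qm C W * M) = topR M + C * botR M := by
  ext i j
  simp only [topR, botR, Qm, Matrix.of_apply, Matrix.mul_apply, Matrix.add_apply, Fin.sum_univ_add]
  simp [Matrix.one_apply]

lemma botR_Qm {m N q : ℕ} (C : Matrix (Fin m) (Fin N) ℂ) (W : Matrix (Fin N) (Fin N) ℂ)
    (M : Matrix (Fin (m + N)) (Fin q) ℂ) : botR (Qm C W * M) = W * botR M := by
  ext i j
  simp only [botR, Qm, Matrix.of_apply, Matrix.mul_apply, Fin.sum_univ_add]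
  simp

lemma strict_mk (m n d : ℕ) (hn : 1 ≤ n) (hd : 1 ≤ d) (hq : n * (d - 1) + n = n * d)
    (L : Pencil (m + n*(d-1)) (n*d))
    (V : Matrix (Fin (n * d)) (Fin (n * d)) ℂ) (W : Matrix (Fin (n * (d - 1))) (Fin (n * (d - 1))) ℂ)
    (hV : IsUnit V) (hW : IsUnit W)
    (h1 : botR L.1 * V = W * Em (n * (d - 1)) n (n * d))
    (h2 : botR L.2 * V = - (W * Fm (n * (d - 1)) (n * d))) :
    StrictEquiv L (comp m n d (mkPol m n d (topR L.1 * V) (topR L.2 * V))) := by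
  set X := topR L.1 * V with hX
  set Y := topR L.2 * V with hY
  let C : Matrix (Fin m) (Fin (n * (d - 1))) ℂ := Matrix.of fun i k => xe X i (k + n)
  have hQ := Qm_isUnit C W hW
  have hQd := (Matrix.isUnit_iff_isUnit_det _).mp hQ
  refine ⟨Qm C W, V, hQ, hV, ?_, ?_⟩
  · rw [Matrix.mul_assoc]
    have : L.1 * V = Qm C W * compA m n d (mkPol m n d X Y) := by
      apply ext_top_bot
      · rw [topR_Qm, topR_mul, ← hX, botR_compA]
        ext i j
        rw [Matrix.add_apply, topR_compA_mk, mul_Em hq]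
        split_ifs with h h' h'
        · omega
        · simp
        · simp only [C, Matrix.of_apply]
          rw [Nat.sub_add_cancel h', xe_fin, zero_add]
        · omega
      · rw [botR_Qm, botR_mul, botR_compA, h1]
    rw [this]
    exact Matrix.nonsing_inv_mul_cancel_left _ _ hQd
  · rw [Matrix.mul_assoc]
    have : L.2 * V = Qm C W * compB m n d (mkPol m n d X Y) := by
      apply ext_top_bot
      · rw [topR_Qm, topR_mul, ← hY, botR_compB]
        ext i j
        rw [Matrix.add_apply, topR_compB_mk _ _ _ hn hd, Matrix.mul_neg, Matrix.neg_apply, mul_Fm]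
        split_ifs with h
        · simp [C]
        · have : xe X i (j + n) = 0 := by
            unfold xe; rw [dif_neg (by omega)]
          rw [this]; simp
      · rw [botR_Qm, botR_mul, botR_compB, h2, Matrix.mul_neg]
    rw [this]
    exact Matrix.nonsing_inv_mul_cancel_left _ _ hQd

lemma final_arith (p1 p0 u1 u0 Pn δ v w g1 g0 D c : ℝ) (d : ℝ) (hd : 1 ≤ d)
    (hp1 : 0 ≤ p1) (hp0 : 0 ≤ p0) (hu1 : 0 ≤ u1) (hu0 : 0 ≤ u0) (hP : 0 ≤ Pn) (hδ : 0 ≤ δ)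
    (hv : 0 ≤ v) (hp : p1 ^ 2 + p0 ^ 2 ≤ Pn ^ 2) (hu : u1 ^ 2 + u0 ^ 2 ≤ δ ^ 2)
    (hw : w = 1 + v) (hg1 : 0 ≤ g1) (hg0 : 0 ≤ g0)
    (h1 : g1 ≤ p1 * v + u1 * w) (h0 : g0 ≤ p0 * v + u0 * w)
    (hc : c = Real.sqrt 2) (hvb : (1 - 0.38) * v ≤ d * (c * δ)) (hv1 : w * (1 - 0.38) ≤ 1)
    (hD : 0 ≤ D) (hDg : D ^ 2 ≤ 2 * (g1 ^ 2 + g0 ^ 2)) :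
    D ≤ 4 * d * (1 + Pn) * δ := by
  have hc0 : 0 ≤ c := hc ▸ Real.sqrt_nonneg 2
  have hc2 : c ^ 2 = 2 := by rw [hc]; exact Real.sq_sqrt (by norm_num)
  have hcu : c ≤ 1.42 := by nlinarith
  have hw0 : 0 ≤ w := by linarith
  have cs : p1 * u1 + p0 * u0 ≤ Pn * δ := by
    refine abs_le_of_sq_le_sq' ?_ (by positivity) |>.2
    calc (p1 * u1 + p0 * u0) ^ 2 ≤ (p1 ^ 2 + p0 ^ 2) * (u1 ^ 2 + u0 ^ 2) := by
          nlinarith [sq_nonneg (p1 * u0 - p0 * u1)]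
      _ ≤ Pn ^ 2 * δ ^ 2 := by gcongr
      _ = _ := by ring
  have hG : g1 ^ 2 + g0 ^ 2 ≤ (Pn * v + δ * w) ^ 2 := by
    have a1 : g1 ^ 2 ≤ (p1 * v + u1 * w) ^ 2 := by gcongr
    have a0 : g0 ^ 2 ≤ (p0 * v + u0 * w) ^ 2 := by gcongr
    have b1 := mul_le_mul_of_nonneg_right hp (sq_nonneg v)
    have b2 := mul_le_mul_of_nonneg_right hu (sq_nonneg w)
    have b3 := mul_le_mul_of_nonneg_right cs (mul_nonneg hv hw0)
    nlinarith
  have hD2 : D ≤ c * (Pn * v + δ * w) := by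
    refine abs_le_of_sq_le_sq' ?_ (by positivity) |>.2
    rw [mul_pow, hc2]; linarith
  have k1 : c * v ≤ 4 * d * δ := by
    have : c * ((1 - 0.38) * v) ≤ c * (d * (c * δ)) := by gcongr
    have e : c * (d * (c * δ)) = 2 * (d * δ) := by rw [← hc2]; ring
    have : 0 ≤ d * δ := by positivity
    linarith
  have k2 : c * w ≤ 4 * d := by nlinarith
  calc D ≤ c * (Pn * v + δ * w) := hD2
    _ = Pn * (c * v) + (c * w) * δ := by ring
    _ ≤ Pn * (4 * d * δ) + (4 * d) * δ := by gcongr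
    _ = _ := by ring

lemma main_aux (m n d : ℕ) (hn : 1 ≤ n) (hd : 1 ≤ d)
    (P : Pol d m n) (L : Pencil (m + n*(d-1)) (n*d))
    (hL : penDist (comp m n d P) L < Real.pi / (12 * (d : ℝ) ^ ((3 : ℝ) / 2))) :
    ∃ Pt : Pol d m n, StrictEquiv L (comp m n d Pt) ∧
      penDist (comp m n d P) (comp m n d Pt)
        ≤ 4 * d * (1 + polNorm P) * penDist (comp m n d P) L := by
  have hq : n * (d - 1) + n = n * d := by
    rw [← Nat.mul_succ]; congr 1; omega
  have hd1 : (1 : ℝ) ≤ d := by exact_mod_cast hd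
  set δ := penDist (comp m n d P) L with hδdef
  have hδ0 : 0 ≤ δ := Real.sqrt_nonneg _
  -- numerical consequence
  have hnum : (d : ℝ) * Real.sqrt d * δ < 0.2625 := by
    have e : (d : ℝ) ^ ((3 : ℝ) / 2) = d * Real.sqrt d := by
      rw [Real.sqrt_eq_rpow, show (3 : ℝ) / 2 = 1 + 1 / 2 by norm_num,
        Real.rpow_add (by linarith), Real.rpow_one]
    have hs : 0 < Real.sqrt d := Real.sqrt_pos.mpr (by linarith)
    rw [e, lt_div_iff₀ (by positivity)] at hL
    have := Real.pi_lt_d2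
    nlinarith
  let DE := botR L.1 - Em (n * (d - 1)) n (n * d)
  let DF := - botR L.2 - Fm (n * (d - 1)) (n * d)
  let U1 := topR L.1 - topR (compA m n d P)
  let U0 := topR L.2 - topR (compB m n d P)
  have hδ2 : δ ^ 2 = ‖U1‖ ^ 2 + ‖DE‖ ^ 2 + (‖U0‖ ^ 2 + ‖DF‖ ^ 2) := by
    rw [hδdef, penDist_sq, norm_top_bot, norm_top_bot]
    have e1 : topR ((comp m n d P).1 - L.1) = - U1 := by
      simp only [U1, neg_sub]; rfl
    have e2 : topR ((comp m n d P).2 - L.2) = - U0 := by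
      simp only [U0, neg_sub]; rfl
    have e3 : botR ((comp m n d P).1 - L.1) = - DE := by
      simp only [DE, neg_sub]; rw [← botR_compA m n d P]; rfl
    have e4 : botR ((comp m n d P).2 - L.2) = DF := by
      have : DF = - Fm (n * (d - 1)) (n * d) - botR L.2 := by simp only [DF]; abel
      rw [this, ← botR_compB m n d P]; rfl
    rw [e1, e2, e3, e4, norm_neg, norm_neg, norm_neg]
  have hc0 := Real.sqrt_nonneg 2
  have hc2 : Real.sqrt 2 ^ 2 = 2 := Real.sq_sqrt (by norm_num)
  have hab : ‖DE‖ + ‖DF‖ ≤ Real.sqrt 2 * δ := by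
    refine abs_le_of_sq_le_sq' ?_ (by positivity) |>.2
    rw [mul_pow, hc2, hδ2]
    nlinarith [sq_nonneg (‖DE‖ - ‖DF‖), sq_nonneg ‖U1‖, sq_nonneg ‖U0‖]
  have hsd : 1 ≤ Real.sqrt d := Real.one_le_sqrt.mpr hd1
  have hdδ : (d : ℝ) * δ < 0.2625 := by
    have : (d : ℝ) * δ * 1 ≤ d * δ * Real.sqrt d := by gcongr
    linarith
  have hθ : d * (‖DE‖ + ‖DF‖) ≤ 0.38 := by
    have h1 : d * (‖DE‖ + ‖DF‖) ≤ d * (Real.sqrt 2 * δ) := by gcongr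
    have hcu : Real.sqrt 2 ≤ 1.42 := by nlinarith
    have h2 : Real.sqrt 2 * (d * δ) ≤ 1.42 * 0.2625 := by gcongr
    linarith
  obtain ⟨V, W, hE, hF, hVn, hWn⟩ := core n d (n * d) hn hq rfl DE DF 0.38 hθ (by norm_num)
  have hv0 := norm_nonneg (V - 1)
  have hVu : IsUnit V := isUnit_of_close V (by linarith)
  have hWu : IsUnit W := by
    rcases Nat.lt_or_ge 1 d with h2 | h2
    · apply isUnit_of_close
      have hd2 : (2 : ℝ) ≤ d := by exact_mod_cast h2
      have hsd2 : Real.sqrt 2 ≤ Real.sqrt d := Real.sqrt_le_sqrt hd2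
      have hx : (d : ℝ) * (‖DE‖ + ‖DF‖) ≤ 0.2625 := by
        have h1 : d * (‖DE‖ + ‖DF‖) ≤ d * (Real.sqrt 2 * δ) := by gcongr
        have h3 : d * (Real.sqrt 2 * δ) ≤ d * (Real.sqrt d * δ) := by gcongr
        linarith
      have hb : ‖DF‖ ≤ 0.14 := by
        have := norm_nonneg DE
        have := norm_nonneg DF
        nlinarith
      have hv : ‖V - 1‖ ≤ 0.43 := by linarith
      have : ‖DF‖ * (1 + ‖V - 1‖) ≤ 0.14 * (1 + 0.43) := by gcongr
      linarith
    · have : d = 1 := by omega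
      subst this
      haveI : IsEmpty (Fin (n * (1 - 1))) := by
        simp only [Nat.sub_self, Nat.mul_zero]; infer_instance
      rw [Matrix.isUnit_iff_isUnit_det, Matrix.det_isEmpty]
      exact isUnit_one
  refine ⟨mkPol m n d (topR L.1 * V) (topR L.2 * V), strict_mk m n d hn hd hq L V W hVu hWu ?_ ?_, ?_⟩
  · rw [← hE]; simp [DE]
  · rw [← hF]; simp [DF]
  · have hdist := dist_mk m n d hn hd P (topR L.1 * V) (topR L.2 * V)
    have hgen : ∀ T M : Matrix (Fin m) (Fin (n * d)) ℂ,
        ‖T * V - M‖ ≤ ‖M‖ * ‖V - 1‖ + ‖T - M‖ * (1 + ‖V - 1‖) := by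
      intro T M
      have e : T * V - M = M * (V - 1) + ((T - M) + (T - M) * (V - 1)) := by
        simp only [Matrix.mul_sub, Matrix.sub_mul, Matrix.mul_one]; abel
      rw [e]
      have a1 := Matrix.frobenius_norm_mul M (V - 1)
      have a2 := Matrix.frobenius_norm_mul (T - M) (V - 1)
      have a3 := norm_add_le (M * (V - 1)) ((T - M) + (T - M) * (V - 1))
      have a4 := norm_add_le (T - M) ((T - M) * (V - 1))
      linarith
    refine final_arith ‖topR (compA m n d P)‖ ‖topR (compB m n d P)‖ ‖U1‖ ‖U0‖ (polNorm P) δ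
      ‖V - 1‖ _ _ _ _ (Real.sqrt 2) d hd1 (norm_nonneg _) (norm_nonneg _) (norm_nonneg _)
      (norm_nonneg _) (Real.sqrt_nonneg _) hδ0 hv0 (top_le_polNorm m n d hn hd P) ?_ rfl
      (norm_nonneg _) (norm_nonneg _) (hgen _ _) (hgen _ _) rfl ?_ ?_ (Real.sqrt_nonneg _) hdist
    · rw [hδ2]; nlinarith [sq_nonneg ‖DE‖, sq_nonneg ‖DF‖]
    · refine hVn.trans ?_
      gcongr
    · linarith

end Helpers

/-- Any pencil sufficiently close to a first companion form is strictly
equivalent to a nearby first companion form, with an explicit bound. -/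
theorem pencil_near_companion (m n d : ℕ) (hm : 1 ≤ m) (hn : 1 ≤ n) (hd : 1 ≤ d)
    (P : Pol d m n) (L : Pencil (m + n*(d-1)) (n*d))
    (hL : penDist (comp m n d P) L < Real.pi / (12 * (d : ℝ) ^ ((3 : ℝ) / 2))) :
    ∃ Pt : Pol d m n, StrictEquiv L (comp m n d Pt) ∧
      penDist (comp m n d P) (comp m n d Pt)
        ≤ 4 * d * (1 + polNorm P) * penDist (comp m n d P) L := by
  exact main_aux m n d hn hd P L hL

end MPoly
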